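/- Morphisms of complex mixed Hodge structures are automatically strict with respect to each of the three filtrations: if f : (V, W, F, F') → (V', W', G, G') is a morphism of ℂ-MHS, then f(W_k) = f(V) ∩ W'_k, f(F^p) = f(V) ∩ G^p, and f(F'^p) = f(V) ∩ G'^p for all k, p ∈ ℤ. -/

import Mathlib

/-- A finite decreasing filtration on a complex vector space `V`. -/
def IsDecFiltration {V : Type*} [AddCommGroup V] [Module ℂ V]
    (F : ℤ → Submodule ℂ V) : Prop :=
  (∀ p : ℤ, F (p + 1) ≤ F p) ∧ (∃ p₀ : ℤ, ∀ p ≤ p₀, F p = ⊤) ∧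
    (∃ p₁ : ℤ, ∀ p ≥ p₁, F p = ⊥)

/-- Two finite decreasing filtrations `F, F'` on `V` are `k`-opposed if
`V = F^p ⊕ F'^{k+1−p}` for every `p`. -/
def KOpposed {V : Type*} [AddCommGroup V] [Module ℂ V]
    (F F' : ℤ → Submodule ℂ V) (k : ℤ) : Prop :=
  ∀ p : ℤ, IsCompl (F p) (F' (k + 1 - p))

/-- A finite increasing filtration on a complex vector space `V`. -/
def IsIncFiltration {V : Type*} [AddCommGroup V] [Module ℂ V]
    (W : ℤ → Submodule ℂ V) : Prop :=
  (∀ k : ℤ, W (k - 1) ≤ W k) ∧ (∃ k₀ : ℤ, ∀ k ≤ k₀, W k = ⊥) ∧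
    (∃ k₁ : ℤ, ∀ k ≥ k₁, W k = ⊤)

/-- The filtrations induced by `F` and `F'` on `gr^W_k V = W k / W (k−1)` are `k`-opposed:
for every `p`, the images of `F^p ∩ W_k` and `F'^{k+1−p} ∩ W_k` in `V / W_{k−1}` give a
direct sum decomposition of the image of `W_k`. -/
def GrKOpposed {V : Type*} [AddCommGroup V] [Module ℂ V]
    (W F F' : ℤ → Submodule ℂ V) (k : ℤ) : Prop :=
  ∀ p : ℤ,
    ((F p ⊓ W k).map (W (k - 1)).mkQ ⊔ (F' (k + 1 - p) ⊓ W k).map (W (k - 1)).mkQ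
        = (W k).map (W (k - 1)).mkQ) ∧
    ((F p ⊓ W k).map (W (k - 1)).mkQ ⊓ (F' (k + 1 - p) ⊓ W k).map (W (k - 1)).mkQ = ⊥)

/-- A complex mixed Hodge structure on `V`: a finite increasing weight filtration `W` and
finite decreasing filtrations `F`, `F'` inducing `k`-opposed filtrations on each
`gr^W_k V`. -/
def IsCMHS {V : Type*} [AddCommGroup V] [Module ℂ V]
    (W F F' : ℤ → Submodule ℂ V) : Prop :=
  IsIncFiltration W ∧ IsDecFiltration F ∧ IsDecFiltration F' ∧
    ∀ k : ℤ, GrKOpposed W F F' k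

section helpers

variable {V : Type*} [AddCommGroup V] [Module ℂ V]

/-- Deligne type bigrading (intersection form). -/
def dI (W F F' : ℤ → Submodule ℂ V) (s : ℤ × ℤ) : Submodule ℂ V :=
  F s.1 ⊓ W (s.1 + s.2) ⊓ ⨅ n : ℕ, (F' (s.2 - n) ⊔ W (s.1 + s.2 - n - 2))

lemma inc_mono {W : ℤ → Submodule ℂ V} (h : IsIncFiltration W) : Monotone W := by
  apply monotone_int_of_le_succ
  intro n
  simpa using h.1 (n + 1)

lemma dec_anti {F : ℤ → Submodule ℂ V} (h : IsDecFiltration F) : Antitone F :=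
  antitone_int_of_succ_le h.1

lemma gr_split {W F F' : ℤ → Submodule ℂ V} {k : ℤ} (h : GrKOpposed W F F' k)
    (p q : ℤ) (hpq : p + q = k + 1) {x : V} (hx : x ∈ W k) :
    ∃ u ∈ F p, u ∈ W k ∧ ∃ v ∈ F' q, v ∈ W k ∧ x - u - v ∈ W (k - 1) := by
  obtain rfl : q = k + 1 - p := by omega
  have h1 : (W (k - 1)).mkQ x ∈ (W k).map (W (k - 1)).mkQ := Submodule.mem_map_of_mem hx
  rw [← (h p).1, Submodule.mem_sup] at h1
  obtain ⟨_, ⟨u, hu, rfl⟩, _, ⟨v, hv, rfl⟩, e⟩ := h1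
  refine ⟨u, hu.1, hu.2, v, hv.1, hv.2, ?_⟩
  rw [← Submodule.Quotient.mk_eq_zero]
  simp only [Submodule.mkQ_apply] at e
  simp [← e]

lemma gr_inter {W F F' : ℤ → Submodule ℂ V} {k : ℤ} (h : GrKOpposed W F F' k)
    (p q : ℤ) (hpq : p + q = k + 1) {u v : V} (hu : u ∈ F p) (hu' : u ∈ W k)
    (hv : v ∈ F' q) (hv' : v ∈ W k) (huv : u - v ∈ W (k - 1)) : u ∈ W (k - 1) := by
  obtain rfl : q = k + 1 - p := by omega
  have e : (W (k - 1)).mkQ u = (W (k - 1)).mkQ v := by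
    rw [← sub_eq_zero, ← map_sub]
    exact (Submodule.Quotient.mk_eq_zero _).2 huv
  have h1 : (W (k - 1)).mkQ u ∈ (F p ⊓ W k).map (W (k - 1)).mkQ :=
    Submodule.mem_map_of_mem ⟨hu, hu'⟩
  have h2 : (W (k - 1)).mkQ u ∈ (F' (k + 1 - p) ⊓ W k).map (W (k - 1)).mkQ := by
    rw [e]
    exact Submodule.mem_map_of_mem ⟨hv, hv'⟩
  have h3 := Submodule.mem_inf.2 ⟨h1, h2⟩
  rw [(h p).2] at h3
  simpa using h3

lemma cmhs_symm {W F F' : ℤ → Submodule ℂ V} (h : IsCMHS W F F') : IsCMHS W F' F := by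
  refine ⟨h.1, h.2.2.1, h.2.1, fun k p => ?_⟩
  have := h.2.2.2 k (k + 1 - p)
  rw [show k + 1 - (k + 1 - p) = p by ring] at this
  exact ⟨by rw [sup_comm]; exact this.1, by rw [inf_comm]; exact this.2⟩

lemma dI_inj {W F F' : ℤ → Submodule ℂ V} (h : IsCMHS W F F') {s : ℤ × ℤ} {x : V}
    (hx : x ∈ dI W F F' s) (hx' : x ∈ W (s.1 + s.2 - 1)) : x = 0 := by
  obtain ⟨hW, hF, hF', hgr⟩ := h
  obtain ⟨⟨hxF, hxW⟩, hxI⟩ := hx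
  simp only [SetLike.mem_coe, Submodule.mem_iInf] at hxF hxW hxI
  have key : ∀ n : ℕ, x ∈ W (s.1 + s.2 - 1 - n) := by
    intro n
    induction n with
    | zero => simpa using hx'
    | succ n ih =>
      obtain ⟨a, ha, w, hw, e⟩ := Submodule.mem_sup.1 (hxI n)
      have hw' : w ∈ W (s.1 + s.2 - 1 - n - 1) := by
        convert hw using 2; ring
      have ha' : a ∈ W (s.1 + s.2 - 1 - n) := by
        have : a = x - w := by rw [← e]; abel
        rw [this]
        exact sub_mem ih (inc_mono hW (by omega) hw')
      have := gr_inter (hgr (s.1 + s.2 - 1 - n)) s.1 (s.2 - n) (by ring) hxF ih ha ha'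
        (by rw [← e]; simpa using hw')
      convert this using 2
      push_cast; ring
  obtain ⟨k₀, hk⟩ := hW.2.1
  have := key (s.1 + s.2 - 1 - k₀).toNat
  rw [hk _ (by omega)] at this
  simpa using this

lemma dI_indep {W F F' : ℤ → Submodule ℂ V} (h : IsCMHS W F F') (g : ℤ × ℤ → V)
    (hg : ∀ s, g s ∈ dI W F F' s) :
    ∀ (n : ℕ) (S : Finset (ℤ × ℤ)), S.card = n → ∑ s ∈ S, g s = 0 → ∀ s ∈ S, g s = 0 := by
  intro n
  induction n with
  | zero =>
    intro S hS _ s hs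
    rw [Finset.card_eq_zero] at hS
    simp [hS] at hs
  | succ n ih =>
    intro S hS hsum
    have hne : S.Nonempty := by
      rw [← Finset.card_pos]; omega
    obtain ⟨m, hm, hmax⟩ := Finset.exists_max_image S
      (fun s => toLex ((s.1 + s.2 : ℤ), (-s.1 : ℤ))) hne
    have hsum2 := Finset.add_sum_erase S g hm
    rw [hsum] at hsum2
    -- the remaining terms
    have hrest : ∑ s ∈ S.erase m, g s ∈
        (F (m.1 + 1) ⊓ W (m.1 + m.2)) ⊔ W (m.1 + m.2 - 1) := by
      refine sum_mem fun s hs => ?_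
      obtain ⟨hsm, hsS⟩ := Finset.mem_erase.1 hs
      have h1 := hmax s hsS
      rw [Prod.Lex.toLex_le_toLex] at h1
      obtain ⟨⟨h2, h3⟩, _⟩ := hg s
      rcases h1 with h1 | ⟨h1, h1'⟩
      · exact Submodule.mem_sup_right (inc_mono h.1 (by simp at h1; omega) h3)
      · simp only at h1 h1'
        have : s.1 ≠ m.1 := by
          intro e
          exact hsm (Prod.ext e (by omega))
        exact Submodule.mem_sup_left
          ⟨dec_anti h.2.1 (by omega) h2, inc_mono h.1 (by omega) h3⟩
    have hm0 : g m = 0 := by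
      refine dI_inj h (hg m) ?_
      obtain ⟨b, ⟨hbF, hbW⟩, w, hw, e⟩ := Submodule.mem_sup.1 hrest
      obtain ⟨⟨_, h3⟩, h4⟩ := hg m
      simp only [SetLike.mem_coe, Submodule.mem_iInf] at h3 h4 hbF hbW
      obtain ⟨a, ha, w', hw', e'⟩ := Submodule.mem_sup.1 (h4 0)
      have hw2 : w' ∈ W (m.1 + m.2 - 1) := inc_mono h.1 (by push_cast; omega) hw'
      have ha' : a ∈ W (m.1 + m.2) := by
        have : a = g m - w' := by rw [← e']; abel
        rw [this]
        exact sub_mem h3 (inc_mono h.1 (by omega) hw2)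
      have e2 : b + a = - w - w' := by
        rw [← e, ← e'] at hsum2
        rw [← sub_eq_zero, ← hsum2]; abel
      have hb := gr_inter (h.2.2.2 (m.1 + m.2)) (m.1 + 1) m.2 (by ring) hbF hbW
        (v := -a) (neg_mem (by simpa using ha)) (neg_mem ha')
        (by rw [sub_neg_eq_add, e2]; exact sub_mem (neg_mem hw) hw2)
      have : g m = - b - w := by
        rw [← e] at hsum2
        rw [← sub_eq_zero, ← hsum2]; abel
      rw [this]
      exact sub_mem (neg_mem hb) hw
    rw [hm0, zero_add] at hsum2
    have := ih (S.erase m) (by rw [Finset.card_erase_of_mem hm]; omega) hsum2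
    intro s hs
    by_cases e : s = m
    · rw [e, hm0]
    · exact this s (Finset.mem_erase.2 ⟨e, hs⟩)

lemma dI_lift {W F F' : ℤ → Submodule ℂ V} (h : IsCMHS W F F') {p q : ℤ} {x : V}
    (hxF : x ∈ F p) (hxW : x ∈ W (p + q)) (hx : x ∈ F' q ⊔ W (p + q - 1)) :
    ∃ y ∈ dI W F F' (p, q), x - y ∈ F p ⊓ W (p + q - 1) := by
  obtain ⟨hW, hF, hF', hgr⟩ := h
  have key : ∀ n : ℕ, ∃ y ∈ F p, y ∈ F' (q - n) ⊔ W (p + q - n - 1) ∧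
      x - y ∈ F p ⊓ W (p + q - 1) ∧
      ∀ i : ℕ, i < n → y ∈ F' (q - i) ⊔ W (p + q - i - 2) := by
    intro n
    induction n with
    | zero => exact ⟨x, hxF, by simpa using hx, by simp, by simp⟩
    | succ n ih =>
      obtain ⟨y, hyF, hy, hxy, hi⟩ := ih
      obtain ⟨a, ha, w, hw, e⟩ := Submodule.mem_sup.1 hy
      obtain ⟨u, huF, huW, v, hvF, hvW, hr⟩ :=
        gr_split (hgr (p + q - n - 1)) p (q - n) (by ring) hw
      have hn : y - u ∈ F' (q - n) ⊔ W (p + q - n - 2) := by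
        refine Submodule.mem_sup.2 ⟨a + v, add_mem ha hvF, w - u - v, ?_, ?_⟩
        · convert hr using 2; ring
        · rw [← e]; abel
      refine ⟨y - u, sub_mem hyF huF, ?_, ?_, ?_⟩
      · refine sup_le_sup (dec_anti hF' ?_) (inc_mono hW ?_) hn <;> push_cast <;> omega
      · have : x - (y - u) = (x - y) + u := by abel
        rw [this]
        exact add_mem hxy ⟨huF, inc_mono hW (by omega) huW⟩
      · intro i hin
        rcases Nat.lt_succ_iff_lt_or_eq.1 hin with h1 | rfl
        · exact sub_mem (hi i h1) (Submodule.mem_sup_right (inc_mono hW (by omega) huW))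
        · exact hn
  obtain ⟨k₀, hk⟩ := hW.2.1
  obtain ⟨y, hyF, hy, hxy, hi⟩ := key (p + q - k₀).toNat
  refine ⟨y, ⟨⟨hyF, ?_⟩, ?_⟩, hxy⟩
  · have : y = x - (x - y) := by abel
    rw [this]
    exact sub_mem hxW (inc_mono hW (by simp) hxy.2)
  · simp only [SetLike.mem_coe, Submodule.mem_iInf]
    intro i
    by_cases h1 : i < (p + q - k₀).toNat
    · exact hi i h1
    · rw [hk (p + q - _ - 1) (by omega), sup_bot_eq] at hy
      exact Submodule.mem_sup_left (dec_anti hF' (by simp; omega) hy)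

lemma dI_span {W F F' : ℤ → Submodule ℂ V} (h : IsCMHS W F F') (k p : ℤ) :
    F p ⊓ W k ≤ ⨆ s : ℤ × ℤ, ⨆ _ : p ≤ s.1 ∧ s.1 + s.2 ≤ k, dI W F F' s := by
  obtain ⟨k₀, hk⟩ := h.1.2.1
  obtain ⟨p₁, hp⟩ := h.2.1.2.2
  have mono : ∀ {p p' k k' : ℤ}, p ≤ p' → k' ≤ k →
      (⨆ s : ℤ × ℤ, ⨆ _ : p' ≤ s.1 ∧ s.1 + s.2 ≤ k', dI W F F' s) ≤
      ⨆ s : ℤ × ℤ, ⨆ _ : p ≤ s.1 ∧ s.1 + s.2 ≤ k, dI W F F' s := by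
    intro p p' k k' h1 h2
    refine iSup_mono fun s => iSup_le fun hs => ?_
    exact le_iSup_of_le ⟨by omega, by omega⟩ le_rfl
  have key : ∀ n : ℕ, ∀ k p : ℤ, (k - k₀).toNat + (p₁ - p).toNat ≤ n →
      F p ⊓ W k ≤ ⨆ s : ℤ × ℤ, ⨆ _ : p ≤ s.1 ∧ s.1 + s.2 ≤ k, dI W F F' s := by
    intro n
    induction n with
    | zero =>
      intro k p hn
      rw [hk k (by omega)]
      simp
    | succ n ih =>
      intro k p hn
      by_cases c1 : k ≤ k₀
      · rw [hk k c1]; simp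
      by_cases c2 : p₁ ≤ p
      · rw [hp p c2]; simp
      rintro x ⟨hxF, hxW⟩
      obtain ⟨u, huF, huW, v, hvF, hvW, hr⟩ :=
        gr_split (h.2.2.2 k) (p + 1) (k - p) (by ring) hxW
      have ek : p + (k - p) = k := by ring
      obtain ⟨y, hy, hxy⟩ := dI_lift h (p := p) (q := k - p) (x := x - u)
        (sub_mem hxF (h.2.1.1 p huF)) (by rw [ek]; exact sub_mem hxW huW)
        (by
          rw [ek]
          exact Submodule.mem_sup.2 ⟨v, hvF, x - u - v, hr, by abel⟩)
      rw [ek] at hxy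
      have e : x = u + y + (x - u - y) := by abel
      rw [e]
      refine add_mem (add_mem ?_ ?_) ?_
      · exact mono (by omega) le_rfl (ih k (p + 1) (by omega) ⟨huF, huW⟩)
      · exact Submodule.mem_iSup_of_mem (p, k - p)
          (Submodule.mem_iSup_of_mem ⟨le_rfl, by simp⟩ hy)
      · exact mono le_rfl (by omega) (ih (k - 1) p (by omega) hxy)
  exact key _ k p le_rfl

lemma dI_map {V' : Type*} [AddCommGroup V'] [Module ℂ V']
    {W F F' : ℤ → Submodule ℂ V} {W' G G' : ℤ → Submodule ℂ V'}
    (f : V →ₗ[ℂ] V')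
    (hfW : ∀ k : ℤ, (W k).map f ≤ W' k)
    (hfF : ∀ p : ℤ, (F p).map f ≤ G p)
    (hfF' : ∀ p : ℤ, (F' p).map f ≤ G' p) (s : ℤ × ℤ) {x : V} (hx : x ∈ dI W F F' s) :
    f x ∈ dI W' G G' s := by
  obtain ⟨⟨h1, h2⟩, h3⟩ := hx
  refine ⟨⟨hfF _ (Submodule.mem_map_of_mem h1), hfW _ (Submodule.mem_map_of_mem h2)⟩, ?_⟩
  simp only [SetLike.mem_coe, Submodule.mem_iInf] at h3 ⊢
  intro n
  have := Submodule.mem_map_of_mem (f := f) (h3 n)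
  rw [Submodule.map_sup] at this
  exact sup_le_sup (hfF' _) (hfW _) this

lemma dI_strict {V' : Type*} [AddCommGroup V'] [Module ℂ V']
    {W F F' : ℤ → Submodule ℂ V} {W' G G' : ℤ → Submodule ℂ V'}
    (hV : IsCMHS W F F') (hV' : IsCMHS W' G G')
    (f : V →ₗ[ℂ] V')
    (hfW : ∀ k : ℤ, (W k).map f ≤ W' k)
    (hfF : ∀ p : ℤ, (F p).map f ≤ G p)
    (hfF' : ∀ p : ℤ, (F' p).map f ≤ G' p)
    (P : ℤ × ℤ → Prop) (D : Submodule ℂ V) (H : Submodule ℂ V')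
    (hD : ∀ s, P s → dI W F F' s ≤ D)
    (hH : H ≤ ⨆ s : ℤ × ℤ, ⨆ _ : P s, dI W' G G' s) :
    LinearMap.range f ⊓ H ≤ D.map f := by
  classical
  rintro _ ⟨⟨x, rfl⟩, hx⟩
  have hxs : x ∈ ⨆ s : ℤ × ℤ, dI W F F' s := by
    obtain ⟨k₁, hk⟩ := hV.1.2.2
    obtain ⟨p₀, hp⟩ := hV.2.1.2.1
    have h1 := dI_span hV k₁ p₀
    rw [hk _ le_rfl, hp _ le_rfl, inf_top_eq] at h1
    exact (h1.trans (iSup_mono fun s => iSup_le fun _ => le_rfl)) Submodule.mem_top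
  obtain ⟨a, ha, hax⟩ := (Submodule.mem_iSup_iff_exists_finsupp _ _).1 hxs
  obtain ⟨b, hb, hbx⟩ := (Submodule.mem_iSup_iff_exists_finsupp _ _).1 (hH hx)
  have hb1 : ∀ s, b s ∈ dI W' G G' s := fun s =>
    (iSup_le fun _ => le_rfl : (⨆ _ : P s, dI W' G G' s) ≤ _) (hb s)
  have hb2 : ∀ s, ¬ P s → b s = 0 := fun s hs => by
    have := hb s
    simpa [hs] using this
  have hax' : ∑ s ∈ a.support ∪ b.support, a s = x := by
    rw [← hax, Finsupp.sum]
    refine (Finset.sum_subset Finset.subset_union_left ?_).symm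
    intro s _ hs
    simpa using hs
  have hbx' : ∑ s ∈ a.support ∪ b.support, b s = f x := by
    rw [← hbx, Finsupp.sum]
    refine (Finset.sum_subset Finset.subset_union_right ?_).symm
    intro s _ hs
    simpa using hs
  have hz := dI_indep hV' (fun s => f (a s) - b s)
    (fun s => sub_mem (dI_map f hfW hfF hfF' s (ha s)) (hb1 s)) _
    (a.support ∪ b.support) rfl (by
      rw [Finset.sum_sub_distrib, hbx', ← map_sum, hax', sub_self])
  rw [← hax', map_sum]
  refine sum_mem fun s hs => ?_
  by_cases hP : P s
  · exact Submodule.mem_map_of_mem (hD s hP (ha s))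
  · have := hz s hs
    simp only [hb2 s hP, sub_zero] at this
    rw [this]
    exact zero_mem _

lemma strict_F {V' : Type*} [AddCommGroup V'] [Module ℂ V']
    {W F F' : ℤ → Submodule ℂ V} {W' G G' : ℤ → Submodule ℂ V'}
    (hV : IsCMHS W F F') (hV' : IsCMHS W' G G')
    (f : V →ₗ[ℂ] V')
    (hfW : ∀ k : ℤ, (W k).map f ≤ W' k)
    (hfF : ∀ p : ℤ, (F p).map f ≤ G p)
    (hfF' : ∀ p : ℤ, (F' p).map f ≤ G' p) (p : ℤ) :
    (F p).map f = LinearMap.range f ⊓ G p := by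
  refine le_antisymm (le_inf LinearMap.map_le_range (hfF p)) ?_
  refine dI_strict hV hV' f hfW hfF hfF' (fun s => p ≤ s.1) _ _ ?_ ?_
  · intro s hs x hx
    exact dec_anti hV.2.1 hs hx.1.1
  · obtain ⟨k₁, hk⟩ := hV'.1.2.2
    have h1 := dI_span hV' k₁ p
    rw [hk _ le_rfl, inf_top_eq] at h1
    refine h1.trans (iSup_mono fun s => iSup_le fun hs => ?_)
    exact le_iSup_of_le hs.1 le_rfl

lemma strict_W {V' : Type*} [AddCommGroup V'] [Module ℂ V']
    {W F F' : ℤ → Submodule ℂ V} {W' G G' : ℤ → Submodule ℂ V'}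
    (hV : IsCMHS W F F') (hV' : IsCMHS W' G G')
    (f : V →ₗ[ℂ] V')
    (hfW : ∀ k : ℤ, (W k).map f ≤ W' k)
    (hfF : ∀ p : ℤ, (F p).map f ≤ G p)
    (hfF' : ∀ p : ℤ, (F' p).map f ≤ G' p) (k : ℤ) :
    (W k).map f = LinearMap.range f ⊓ W' k := by
  refine le_antisymm (le_inf LinearMap.map_le_range (hfW k)) ?_
  refine dI_strict hV hV' f hfW hfF hfF' (fun s => s.1 + s.2 ≤ k) _ _ ?_ ?_
  · intro s hs x hx
    exact inc_mono hV.1 hs hx.1.2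
  · obtain ⟨p₀, hp⟩ := hV'.2.1.2.1
    have h1 := dI_span hV' k p₀
    rw [hp _ le_rfl, top_inf_eq] at h1
    refine h1.trans (iSup_mono fun s => iSup_le fun hs => ?_)
    exact le_iSup_of_le hs.2 le_rfl

end helpers

/-- Morphisms of complex mixed Hodge structures are strict with respect to each of the
three filtrations: `f(W_k) = f(V) ∩ W'_k`, `f(F^p) = f(V) ∩ G^p`, `f(F'^p) = f(V) ∩ G'^p`. -/
theorem cmhs_morphism_strict
    (V : Type*) [AddCommGroup V] [Module ℂ V] [FiniteDimensional ℂ V]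
    (V' : Type*) [AddCommGroup V'] [Module ℂ V'] [FiniteDimensional ℂ V']
    (W F F' : ℤ → Submodule ℂ V) (W' G G' : ℤ → Submodule ℂ V')
    (hV : IsCMHS W F F') (hV' : IsCMHS W' G G')
    (f : V →ₗ[ℂ] V')
    (hfW : ∀ k : ℤ, (W k).map f ≤ W' k)
    (hfF : ∀ p : ℤ, (F p).map f ≤ G p)
    (hfF' : ∀ p : ℤ, (F' p).map f ≤ G' p) :
    (∀ k : ℤ, (W k).map f = LinearMap.range f ⊓ W' k) ∧
    (∀ p : ℤ, (F p).map f = LinearMap.range f ⊓ G p) ∧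
    (∀ p : ℤ, (F' p).map f = LinearMap.range f ⊓ G' p) := by
  exact ⟨strict_W hV hV' f hfW hfF hfF', strict_F hV hV' f hfW hfF hfF',
    strict_F (cmhs_symm hV) (cmhs_symm hV') f hfW hfF' hfF⟩
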